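/- Let k ≥ 1 and let (f_y)_{y∈{−1,1}^k} be a collection of polymatroids on 2^{[k]}, with F_y the Lovász extension of f_y. Then for all y, y', y'' ∈ {−1,1}^k and every permutation π of [k], the function u ↦ F_{y''}((1 − u ⊙ y')_+) is affine on P_{π,y}; that is, it agrees on P_{π,y} with an affine function of u ∈ ℝ^k. -/

import Mathlib

open Finset
open scoped Classical

noncomputable section

/-- The set `{π_1, …, π_i}` of the first `i` elements under the permutation `π`. -/
def chain (k : ℕ) (π : Equiv.Perm (Fin k)) (i : ℕ) : Finset (Fin k) :=
  (Finset.univ.filter (fun j : Fin k => (j : ℕ) < i)).image π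

/-- The Lovász extension of the set function `f`. -/
def lovaszExt (k : ℕ) (f : Finset (Fin k) → ℝ) (x : Fin k → ℝ) : ℝ :=
  Finset.univ.sup' ⟨1, Finset.mem_univ 1⟩
    (fun π : Equiv.Perm (Fin k) =>
      ∑ i : Fin k, x (π i) * (f (chain k π ((i : ℕ) + 1)) - f (chain k π (i : ℕ))))

/-- A polymatroid: normalized, increasing, submodular. -/
def IsPolymatroid (k : ℕ) (f : Finset (Fin k) → ℝ) : Prop :=
  f ∅ = 0 ∧
  (∀ S T : Finset (Fin k), Disjoint S T → f S ≤ f (S ∪ T)) ∧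
  (∀ S T : Finset (Fin k), f (S ∪ T) + f (S ∩ T) ≤ f S + f T)

def IsSign (k : ℕ) (y : Fin k → ℝ) : Prop := ∀ i, y i = 1 ∨ y i = -1

def IsV (k : ℕ) (v : Fin k → ℝ) : Prop := ∀ i, v i = -1 ∨ v i = 0 ∨ v i = 1

/-- The finite set of sign vectors `{-1,1}^k`. -/
def signVecs (k : ℕ) : Finset (Fin k → ℝ) :=
  Finset.image (fun s : Fin k → Bool => fun i => if s i then (1 : ℝ) else -1) Finset.univ

def misSet (k : ℕ) (v y : Fin k → ℝ) : Finset (Fin k) :=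
  Finset.univ.filter (fun i => v i ≠ y i)

def absSet (k : ℕ) (v : Fin k → ℝ) : Finset (Fin k) :=
  Finset.univ.filter (fun i => v i = 0)

/-- The Lovász hinge for a label-indexed collection of set functions. -/
def hinge (k : ℕ) (f : (Fin k → ℝ) → Finset (Fin k) → ℝ) (u y : Fin k → ℝ) : ℝ :=
  lovaszExt k (f y) (fun i => max (1 - u i * y i) 0)

def clip (k : ℕ) (u : Fin k → ℝ) : Fin k → ℝ := fun i => Real.sign (u i) * min |u i| 1

def indVec (k : ℕ) (π : Equiv.Perm (Fin k)) (i : ℕ) : Fin k → ℝ :=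
  fun j => if j ∈ chain k π i then 1 else 0

def Vpy (k : ℕ) (π : Equiv.Perm (Fin k)) (y : Fin k → ℝ) : Set (Fin k → ℝ) :=
  { x | ∃ i ≤ k, x = fun j => indVec k π i j * y j }

def Ppy (k : ℕ) (π : Equiv.Perm (Fin k)) (y : Fin k → ℝ) : Set (Fin k → ℝ) :=
  convexHull ℝ (Vpy k π y)

def psiHat (k : ℕ) (ε : ℝ) (u : Fin k → ℝ) : Set (Fin k → ℝ) :=
  ⋂₀ { V : Set (Fin k → ℝ) |
      (∃ (π : Equiv.Perm (Fin k)) (y : Fin k → ℝ), IsSign k y ∧ V ⊆ Vpy k π y) ∧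
      EMetric.infEdist (clip k u) (convexHull ℝ V) < ENNReal.ofReal ε }

def mval (k : ℕ) (ε : ℝ) (u : Fin k → ℝ) (π : Equiv.Perm (Fin k)) : ℕ → ℝ :=
  fun i => if i = 0 then 1 + ε
    else if h : i ≤ k ∧ 1 ≤ k then |u (π ⟨i - 1, by omega⟩)| else -ε



theorem mem_chain {k : ℕ} {π : Equiv.Perm (Fin k)} {i : ℕ} {j : Fin k} :
    j ∈ chain k π i ↔ (π.symm j : ℕ) < i := by
  simp only [chain, Finset.mem_image, Finset.mem_filter, Finset.mem_univ, true_and]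
  constructor
  · rintro ⟨a, ha, rfl⟩
    simpa using ha
  · intro h
    exact ⟨π.symm j, h, by simp⟩

theorem chain_zero (k : ℕ) (π : Equiv.Perm (Fin k)) : chain k π 0 = ∅ := by
  ext j
  simp [mem_chain]

theorem chain_self (k : ℕ) (π : Equiv.Perm (Fin k)) : chain k π k = Finset.univ := by
  ext j
  simp [mem_chain]

theorem chain_succ {k : ℕ} (π : Equiv.Perm (Fin k)) (i : Fin k) :
    chain k π ((i : ℕ) + 1) = insert (π i) (chain k π i) := by
  ext j
  rw [Finset.mem_insert, mem_chain, mem_chain, ← Equiv.symm_apply_eq, Fin.ext_iff]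
  omega

theorem Fin.sum_univ_sub_telescope {k : ℕ} (a : ℕ → ℝ) :
    ∑ i : Fin k, (a ((i : ℕ) + 1) - a i) = a k - a 0 := by
  rw [Fin.sum_univ_eq_sum_range (fun i => a (i + 1) - a i), Finset.sum_range_sub]

theorem Fin.sum_univ_ite_lt_sub_telescope {k m : ℕ} (hm : m ≤ k) (a : ℕ → ℝ) :
    ∑ i : Fin k, (if (i : ℕ) < m then a ((i : ℕ) + 1) - a i else 0) = a m - a 0 := by
  have h := Fin.sum_univ_sub_telescope (k := k) (fun i => a (min i m))
  simp only [Nat.zero_min, min_eq_right hm] at h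
  rw [← h]
  refine Finset.sum_congr rfl fun i _ => ?_
  split_ifs with hi
  · rw [min_eq_left hi, min_eq_left hi.le]
  · rw [min_eq_right (by omega), min_eq_right (by omega), sub_self]

/-- The greedy vector of a permutation lies in the base polytope of a submodular function. -/
theorem sum_greedy_le {k : ℕ} {f : Finset (Fin k) → ℝ} (hf : IsPolymatroid k f)
    (ρ : Equiv.Perm (Fin k)) (S : Finset (Fin k)) :
    ∑ i : Fin k, (if ρ i ∈ S then f (chain k ρ ((i : ℕ) + 1)) - f (chain k ρ i) else 0)
      ≤ f S := by
  obtain ⟨h0, -, hsub⟩ := hf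
  have h := Fin.sum_univ_sub_telescope (k := k) (fun i => f (S ∩ chain k ρ i))
  simp only [chain_self, chain_zero, Finset.inter_univ, Finset.inter_empty, h0, sub_zero] at h
  rw [← h]
  refine Finset.sum_le_sum fun i _ => ?_
  rw [chain_succ]
  split_ifs with hi
  · have hmem : ρ i ∉ chain k ρ i := by simp [mem_chain]
    have hs := hsub (S ∩ insert (ρ i) (chain k ρ i)) (chain k ρ i)
    have hu : S ∩ insert (ρ i) (chain k ρ i) ∪ chain k ρ i = insert (ρ i) (chain k ρ i) := by
      ext j
      simp only [Finset.mem_union, Finset.mem_inter, Finset.mem_insert]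
      grind
    have hn : S ∩ insert (ρ i) (chain k ρ i) ∩ chain k ρ i = S ∩ chain k ρ i := by
      ext j
      simp only [Finset.mem_inter, Finset.mem_insert]
      tauto
    rw [hu, hn] at hs
    linarith
  · rw [Finset.inter_insert_of_notMem hi, sub_self]

theorem Fin.mul_sum_le_sum_mul_of_antitone {n : ℕ} (x d : Fin n → ℝ) (hx : Antitone x)
    (hd : ∀ m ≤ n, 0 ≤ ∑ i : Fin n, (if (i : ℕ) < m then d i else 0))
    (c : ℝ) (hc : ∀ i, c ≤ x i) : c * ∑ i, d i ≤ ∑ i, x i * d i := by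
  induction n generalizing c with
  | zero => simp
  | succ n ih =>
    have hsum : 0 ≤ ∑ i, d i := by
      simpa only [Fin.is_lt, if_true] using hd (n + 1) le_rfl
    have hprefix := ih (fun i => x i.castSucc) (fun i => d i.castSucc)
      (fun i j hij => hx (Fin.castSucc_le_castSucc_iff.mpr hij))
      (fun m hm => by
        have h := hd m (by omega)
        rw [Fin.sum_univ_castSucc] at h
        simpa [hm.not_gt] using h)
      (x (Fin.last n)) (fun i => hx (Fin.le_last _))
    have hlast := mul_le_mul_of_nonneg_right (hc (Fin.last n)) hsum
    rw [Fin.sum_univ_castSucc] at hlast ⊢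
    rw [Fin.sum_univ_castSucc (fun i => x i * d i)]
    linarith

/-- The Lovász extension is attained at any permutation sorting the argument decreasingly. -/
theorem lovaszExt_eq_of_antitone {k : ℕ} {f : Finset (Fin k) → ℝ} (hf : IsPolymatroid k f)
    {x : Fin k → ℝ} (hx0 : ∀ i, 0 ≤ x i) (σ : Equiv.Perm (Fin k)) (hx : Antitone (x ∘ σ)) :
    lovaszExt k f x =
      ∑ i : Fin k, x (σ i) * (f (chain k σ ((i : ℕ) + 1)) - f (chain k σ i)) := by
  refine le_antisymm (Finset.sup'_le _ _ fun ρ _ => ?_)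
    (Finset.le_sup' (fun π : Equiv.Perm (Fin k) =>
      ∑ i : Fin k, x (π i) * (f (chain k π ((i : ℕ) + 1)) - f (chain k π (i : ℕ))))
      (Finset.mem_univ σ))
  set g : Fin k → ℝ := fun j =>
    f (chain k ρ ((ρ.symm j : ℕ) + 1)) - f (chain k ρ (ρ.symm j)) with hg
  have hρ : ∑ i : Fin k, x (ρ i) * (f (chain k ρ ((i : ℕ) + 1)) - f (chain k ρ i)) =
      ∑ i, x (σ i) * g (σ i) := by
    rw [Equiv.sum_comp σ (fun j => x j * g j), ← Equiv.sum_comp ρ (fun j => x j * g j)]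
    simp [hg]
  have key := Fin.mul_sum_le_sum_mul_of_antitone (x ∘ σ)
    (fun i => f (chain k σ ((i : ℕ) + 1)) - f (chain k σ i) - g (σ i)) hx
    (fun m hm => by
      have hσ := Fin.sum_univ_ite_lt_sub_telescope hm (fun i => f (chain k σ i))
      simp only [chain_zero, hf.1, sub_zero] at hσ
      have hb := sum_greedy_le hf ρ (chain k σ m)
      have hgs : ∑ i : Fin k, (if (i : ℕ) < m then g (σ i) else 0) =
          ∑ i : Fin k, (if ρ i ∈ chain k σ m then
            f (chain k ρ ((i : ℕ) + 1)) - f (chain k ρ i) else 0) := by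
        trans ∑ j, if j ∈ chain k σ m then g j else 0
        · rw [← Equiv.sum_comp σ (fun j => if j ∈ chain k σ m then g j else 0)]
          simp [mem_chain]
        · rw [← Equiv.sum_comp ρ (fun j => if j ∈ chain k σ m then g j else 0)]
          simp [hg]
      rw [← hgs, ← hσ, ← sub_nonneg, ← Finset.sum_sub_distrib] at hb
      refine hb.trans_eq (Finset.sum_congr rfl fun i _ => ?_)
      split_ifs <;> simp)
    0 (fun i => hx0 _)
  simp only [zero_mul, Function.comp_apply, mul_sub _ _ (g _), Finset.sum_sub_distrib] at key
  rw [hρ]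
  linarith

/-- Some permutation sorts `u ⊙ y'` increasingly, simultaneously for all `u ∈ P_{π,y}`. -/
theorem exists_perm_monotone_of_mem_Ppy {k : ℕ} {y y' : Fin k → ℝ} (hy : IsSign k y)
    (hy' : IsSign k y') (π : Equiv.Perm (Fin k)) :
    ∃ σ : Equiv.Perm (Fin k), ∀ u ∈ Ppy k π y,
      (∀ i, u i * y' i ≤ 1) ∧ Monotone fun i => u (σ i) * y' (σ i) := by
  set key : Fin k → ℝ := fun j => y j * y' j * ((k : ℝ) - (π.symm j : ℕ)) with hkey
  refine ⟨Tuple.sort key, ?_⟩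
  have hz : ∀ j, y j * y' j = 1 ∨ y j * y' j = -1 := fun j => by
    rcases hy j with h | h <;> rcases hy' j with h' | h' <;> simp [h, h']
  have hpos : ∀ j, (0 : ℝ) < (k : ℝ) - (π.symm j : ℕ) := fun j =>
    sub_pos.mpr (by exact_mod_cast (π.symm j).isLt)
  have hsort : Monotone (key ∘ Tuple.sort key) := Tuple.monotone_sort key
  set σ := Tuple.sort key
  suffices hsub : Ppy k π y ⊆
      {u | (∀ i, u i * y' i ≤ 1) ∧ Monotone fun i => u (σ i) * y' (σ i)} from
    fun u hu => hsub hu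
  refine convexHull_min ?_ ?_
  · rintro _ ⟨n, -, rfl⟩
    have hind : ∀ j, indVec k π n j * y j * y' j =
        if (π.symm j : ℕ) < n then y j * y' j else 0 := fun j => by
      simp [indVec, mem_chain]
    refine ⟨fun j => ?_, fun i j hij => ?_⟩
    · simp only [hind]
      split_ifs
      · rcases hz j with h | h <;> norm_num [h]
      · norm_num
    · have hle : key (σ i) ≤ key (σ j) := hsort hij
      simp only [hind]
      simp only [hkey] at hle
      have hi := hpos (σ i)
      have hj := hpos (σ j)
      rcases hz (σ i) with h | h <;> rcases hz (σ j) with h' | h' <;> rw [h, h'] at hle ⊢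
      · have : (π.symm (σ j) : ℕ) ≤ π.symm (σ i) := by
          have : ((π.symm (σ j) : ℕ) : ℝ) ≤ (π.symm (σ i) : ℕ) := by linarith
          exact_mod_cast this
        split_ifs <;> first | omega | norm_num
      · linarith
      · split_ifs <;> norm_num
      · have : (π.symm (σ i) : ℕ) ≤ π.symm (σ j) := by
          have : ((π.symm (σ i) : ℕ) : ℝ) ≤ (π.symm (σ j) : ℕ) := by linarith
          exact_mod_cast this
        split_ifs <;> first | omega | norm_num
  · rintro u ⟨hu, hu'⟩ v ⟨hv, hv'⟩ a b ha hb hab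
    refine ⟨fun i => ?_, fun i j hij => ?_⟩
    · simp only [Pi.add_apply, Pi.smul_apply, smul_eq_mul]
      nlinarith [mul_le_mul_of_nonneg_left (hu i) ha, mul_le_mul_of_nonneg_left (hv i) hb]
    · simp only [Pi.add_apply, Pi.smul_apply, smul_eq_mul]
      nlinarith [mul_le_mul_of_nonneg_left (hu' hij) ha, mul_le_mul_of_nonneg_left (hv' hij) hb]

/-- For all labels `y, y', y''` and every permutation `π`, the function
`u ↦ F_{y''}((1 - u ⊙ y')₊)` is affine on `P_{π,y}`. -/
theorem lovasz_hinge_affine_on_Ppy (k : ℕ) (hk : 1 ≤ k)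
    (f : (Fin k → ℝ) → Finset (Fin k) → ℝ)
    (hf : ∀ y : Fin k → ℝ, IsSign k y → IsPolymatroid k (f y))
    (y y' y'' : Fin k → ℝ) (hy : IsSign k y) (hy' : IsSign k y') (hy'' : IsSign k y'')
    (π : Equiv.Perm (Fin k)) :
    ∃ (w : Fin k → ℝ) (b : ℝ), ∀ u ∈ Ppy k π y,
      lovaszExt k (f y'') (fun i => max (1 - u i * y' i) 0) = ∑ i, w i * u i + b := by
  obtain ⟨σ, hσ⟩ := exists_perm_monotone_of_mem_Ppy hy hy' π
  set d : Fin k → ℝ := fun i =>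
    f y'' (chain k σ ((i : ℕ) + 1)) - f y'' (chain k σ i) with hd
  refine ⟨fun j => -(y' j * d (σ.symm j)), ∑ i, d i, fun u hu => ?_⟩
  obtain ⟨hle, hmono⟩ := hσ u hu
  have hx : (fun i => max (1 - u i * y' i) 0) = fun i => 1 - u i * y' i :=
    funext fun i => max_eq_left (sub_nonneg.mpr (hle i))
  rw [hx, lovaszExt_eq_of_antitone (hf y'' hy'') (fun i => sub_nonneg.mpr (hle i)) σ
      (fun i j hij => sub_le_sub_left (hmono hij) 1),
    ← Equiv.sum_comp σ (fun j => -(y' j * d (σ.symm j)) * u j), ← Finset.sum_add_distrib]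
  refine Finset.sum_congr rfl fun i _ => ?_
  simp only [Equiv.symm_apply_apply, hd]
  ring

end
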